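/- For every integer n ≥ 2, L_{n,3} = (1/16)(n-2)(9n^5 - 9n^4 - 81n^3 + 81n^2 + 160n - 192), where L_{n,3} = C(M,3) - [14 fixed connected forbidden triples + 6·(V with one extra edge) counts], with M = 3(n-1)n/2; equivalently C(M,3) minus 12·T_{n-2} + T_{n-3} + T_{n-1} (connected forbidden triples) minus the corrected counts of a V plus an uncorrelated edge. -/

import Mathlib

open Finset

/-- The three edges of the upward unit triangle with lower-left corner `p`. -/
def upTri (p : ℕ × ℕ) : Finset (Sym2 (ℕ × ℕ)) :=
  {s(p, (p.1 + 1, p.2)), s(p, (p.1, p.2 + 1)), s((p.1 + 1, p.2), (p.1, p.2 + 1))}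

/-- The three edges of the downward unit triangle associated to `p`. -/
def downTri (p : ℕ × ℕ) : Finset (Sym2 (ℕ × ℕ)) :=
  {s((p.1 + 1, p.2), (p.1, p.2 + 1)), s((p.1 + 1, p.2), (p.1 + 1, p.2 + 1)),
    s((p.1, p.2 + 1), (p.1 + 1, p.2 + 1))}

/-- The upward-pointing unit triangles of the triangular grid of side `n`. -/
def upTris (n : ℕ) : Finset (Finset (Sym2 (ℕ × ℕ))) :=
  ((Finset.range n ×ˢ Finset.range n).filter (fun p => p.1 + p.2 + 1 ≤ n)).image upTri

/-- The downward-pointing unit triangles of the triangular grid of side `n`. -/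
def downTris (n : ℕ) : Finset (Finset (Sym2 (ℕ × ℕ))) :=
  ((Finset.range n ×ˢ Finset.range n).filter (fun p => p.1 + p.2 + 2 ≤ n)).image downTri

/-- All unit triangles (each given as its set of three edges). -/
def unitTris (n : ℕ) : Finset (Finset (Sym2 (ℕ × ℕ))) := upTris n ∪ downTris n

/-- All edges of the triangular grid of side `n`. -/
def allEdges (n : ℕ) : Finset (Sym2 (ℕ × ℕ)) := (unitTris n).sup id

/-- The internal edges: edges belonging to two unit triangles. -/
def internalEdges (n : ℕ) : Finset (Sym2 (ℕ × ℕ)) :=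
  (allEdges n).filter (fun e => 2 ≤ ((unitTris n).filter (fun t => e ∈ t)).card)

/-- A lozenge tiling: a set of internal edges, no two in a common unit triangle. -/
def IsLozengeTiling (n : ℕ) (S : Finset (Sym2 (ℕ × ℕ))) : Prop :=
  S ⊆ internalEdges n ∧ ∀ t ∈ unitTris n, (t ∩ S).card ≤ 1

/-- `L n l`: the number of lozenge tilings of the side-`n` triangle with `l` lozenges. -/
def L (n l : ℕ) : ℕ :=
  (((internalEdges n).powersetCard l).filter
    (fun S => ∀ t ∈ unitTris n, (t ∩ S).card ≤ 1)).card

/-- Three-element subsets of pairwise `R`-related elements, counted through ordered triples. -/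
theorem six_mul_card_powersetCard_three_filter {α : Type*} [DecidableEq α] (I : Finset α)
    (R : α → α → Prop) [DecidableRel R] (hirr : ∀ a ∈ I, ¬ R a a)
    (hsymm : ∀ a b, R a b → R b a) :
    6 * ((((I.powersetCard 3).filter
        (fun S => ∀ a ∈ S, ∀ b ∈ S, a ≠ b → R a b)).card : ℕ) : ℚ) =
      ∑ a ∈ I, ∑ b ∈ I, ∑ c ∈ I, if R a b ∧ R a c ∧ R b c then (1 : ℚ) else 0 := by
  set X := (I ×ˢ I ×ˢ I).filter (fun x => R x.1 x.2.1 ∧ R x.1 x.2.2 ∧ R x.2.1 x.2.2) with hX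
  have hcard : X.card = 6 * ((I.powersetCard 3).filter
        (fun S => ∀ a ∈ S, ∀ b ∈ S, a ≠ b → R a b)).card := by
    rw [mul_comm, ← smul_eq_mul]
    have hmaps : ∀ x ∈ X, ({x.1, x.2.1, x.2.2} : Finset α) ∈ (I.powersetCard 3).filter
        (fun S => ∀ a ∈ S, ∀ b ∈ S, a ≠ b → R a b) := by
      rintro ⟨a, b, c⟩ hx
      simp only [hX, mem_filter, mem_product] at hx
      obtain ⟨⟨ha, hb, hc⟩, hab, hac, hbc⟩ := hx
      have h1 : a ≠ b := by rintro rfl; exact hirr a ha hab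
      have h2 : a ≠ c := by rintro rfl; exact hirr a ha hac
      have h3 : b ≠ c := by rintro rfl; exact hirr b hb hbc
      simp only [mem_filter, mem_powersetCard]
      refine ⟨⟨?_, card_eq_three.2 ⟨a, b, c, h1, h2, h3, rfl⟩⟩, ?_⟩
      · intro z hz
        simp only [mem_insert, mem_singleton] at hz
        rcases hz with rfl | rfl | rfl <;> assumption
      · intro y hy z hz
        simp only [mem_insert, mem_singleton] at hy hz
        intro hyz
        rcases hy with rfl | rfl | rfl <;> rcases hz with rfl | rfl | rfl <;>
          first
            | exact absurd rfl hyz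
            | assumption
            | exact hsymm _ _ (by assumption)
    rw [card_eq_sum_card_fiberwise hmaps]
    refine sum_const_nat ?_
    intro S hS
    simp only [mem_filter, mem_powersetCard] at hS
    obtain ⟨⟨hSI, hS3⟩, hR⟩ := hS
    obtain ⟨x, y, z, hxy, hxz, hyz, rfl⟩ := card_eq_three.1 hS3
    have hx : x ∈ I := hSI (by simp)
    have hy : y ∈ I := hSI (by simp)
    have hz : z ∈ I := hSI (by simp)
    have rxy : R x y := hR x (by simp) y (by simp) hxy
    have rxz : R x z := hR x (by simp) z (by simp) hxz
    have ryz : R y z := hR y (by simp) z (by simp) hyz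
    have hfib : X.filter (fun w => ({w.1, w.2.1, w.2.2} : Finset α) = {x, y, z}) =
        {(x, y, z), (x, z, y), (y, x, z), (y, z, x), (z, x, y), (z, y, x)} := by
      ext ⟨a, b, c⟩
      simp only [hX, mem_filter, mem_product, mem_insert, mem_singleton, Prod.mk.injEq]
      constructor
      · rintro ⟨⟨⟨ha, hb, hc⟩, hab, hac, hbc⟩, he⟩
        have h1 : a ≠ b := by rintro rfl; exact hirr a ha hab
        have h2 : a ≠ c := by rintro rfl; exact hirr a ha hac
        have h3 : b ≠ c := by rintro rfl; exact hirr b hb hbc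
        have ma : a ∈ ({x, y, z} : Finset α) := he ▸ (by simp)
        have mb : b ∈ ({x, y, z} : Finset α) := he ▸ (by simp)
        have mc : c ∈ ({x, y, z} : Finset α) := he ▸ (by simp)
        simp only [mem_insert, mem_singleton] at ma mb mc
        clear he ha hb hc hab hac hbc
        grind only
      · rintro (⟨rfl, rfl, rfl⟩ | ⟨rfl, rfl, rfl⟩ | ⟨rfl, rfl, rfl⟩ | ⟨rfl, rfl, rfl⟩ |
          ⟨rfl, rfl, rfl⟩ | ⟨rfl, rfl, rfl⟩) <;>
        · refine ⟨⟨⟨by assumption, by assumption, by assumption⟩, ?_, ?_, ?_⟩, ?_⟩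
          · first | assumption | (apply hsymm; assumption)
          · first | assumption | (apply hsymm; assumption)
          · first | assumption | (apply hsymm; assumption)
          · ext w
            simp only [mem_insert, mem_singleton] <;> tauto
    rw [hfib]
    simp [hxy, hxz, hyz, hxy.symm, hxz.symm, hyz.symm]
  have : ((X.card : ℕ) : ℚ) =
      ∑ a ∈ I, ∑ b ∈ I, ∑ c ∈ I, if R a b ∧ R a c ∧ R b c then (1 : ℚ) else 0 := by
    rw [hX, card_filter]
    push_cast
    simp only [sum_product]
  rw [← this, hcard]
  push_cast
  ring

/-- Ordered triples of edges of a simple bipartite graph that form a matching, in terms of the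
degrees of the endpoints of each edge. Here `p` and `q` give the two endpoints. -/
theorem sum_matching_triples {α β γ : Type*} [DecidableEq α] [DecidableEq β] [DecidableEq γ]
    (E : Finset α) (p : α → β) (q : α → γ) (hpq : ∀ a b, p a = p b → q a = q b → a = b)
    (dp dq : α → ℚ)
    (hdp : ∀ a ∈ E, ∑ b ∈ E, (if p a = p b then (1 : ℚ) else 0) = dp a)
    (hdq : ∀ a ∈ E, ∑ b ∈ E, (if q a = q b then (1 : ℚ) else 0) = dq a) :
    (∑ a ∈ E, ∑ b ∈ E, ∑ c ∈ E,
      if ¬ (p a = p b ∨ q a = q b) ∧ ¬ (p a = p c ∨ q a = q c) ∧ ¬ (p b = p c ∨ q b = q c)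
        then (1 : ℚ) else 0) =
    ∑ a ∈ E, ((E.card : ℚ) ^ 2 - 3 * E.card * (dp a + dq a - 1) + 3 * (dp a + dq a - 1) ^ 2
      - dp a ^ 2 - dq a ^ 2 + 1) := by
  let P : α → α → ℚ := fun a b => if p a = p b then 1 else 0
  let Q : α → α → ℚ := fun a b => if q a = q b then 1 else 0
  let D : α → α → ℚ := fun a b => if a = b then 1 else 0
  let A : α → α → ℚ := fun a b => P a b + Q a b - D a b
  have hA : ∀ a b, A a b = if p a = p b ∨ q a = q b then 1 else 0 := by
    intro a b
    by_cases h1 : p a = p b <;> by_cases h2 : q a = q b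
    · have := hpq a b h1 h2
      subst this
      simp [A, P, Q, D]
    · have : a ≠ b := by rintro rfl; exact h2 rfl
      simp [A, P, Q, D, *]
    · have : a ≠ b := by rintro rfl; exact h1 rfl
      simp [A, P, Q, D, *]
    · have : a ≠ b := by rintro rfl; exact h1 rfl
      simp [A, P, Q, D, *]
  have hAsymm : ∀ a b, A a b = A b a := by
    intro a b
    simp only [hA, eq_comm]
  have htri : ∀ a b c, A a b * A a c * A b c = P a b * P a c + Q a b * Q a c - D a b * D a c := by
    intro a b c
    have hD : ∀ a b, D a b = P a b * Q a b := by
      intro a b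
      have := hpq a b
      by_cases h : a = b
      · subst h; simp [D, P, Q]
      · by_cases h1 : p a = p b <;> by_cases h2 : q a = q b <;> simp_all [D, P, Q]
    rw [hD a b, hD a c]
    simp only [hA, P, Q]
    by_cases h1 : p a = p b <;> by_cases h2 : q a = q b <;> by_cases h3 : p a = p c <;>
      by_cases h4 : q a = q c <;> simp_all <;> rw [eq_comm] <;> assumption
  have hpoint : ∀ a b c, (if ¬ (p a = p b ∨ q a = q b) ∧ ¬ (p a = p c ∨ q a = q c) ∧
      ¬ (p b = p c ∨ q b = q c) then (1 : ℚ) else 0) =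
      1 - A a b - A a c - A b c + A a b * A a c + A b a * A b c + A c a * A c b
        - (P a b * P a c + Q a b * Q a c - D a b * D a c) := by
    intro a b c
    rw [← htri, hAsymm b a, hAsymm c a, hAsymm c b, hA, hA, hA]
    by_cases h1 : p a = p b ∨ q a = q b <;> by_cases h2 : p a = p c ∨ q a = q c <;>
      by_cases h3 : p b = p c ∨ q b = q c <;> simp [h1, h2, h3]
  have hsA : ∀ a ∈ E, ∑ b ∈ E, A a b = dp a + dq a - 1 := by
    intro a ha
    simp only [A, sum_sub_distrib, sum_add_distrib, P, Q, hdp a ha, hdq a ha, D]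
    simp [ha]
  have hsD : ∀ a ∈ E, ∑ b ∈ E, D a b = 1 := by
    intro a ha
    simp [D, ha]
  have hone : ∀ f : α → α → ℚ, ∑ a ∈ E, ∑ b ∈ E, ∑ c ∈ E, f a b * f a c =
      ∑ a ∈ E, (∑ b ∈ E, f a b) ^ 2 := by
    intro f
    refine sum_congr rfl fun a _ => ?_
    rw [sq, sum_mul_sum]
  have htwo : ∑ a ∈ E, ∑ b ∈ E, ∑ c ∈ E, A b a * A b c = ∑ a ∈ E, (∑ b ∈ E, A a b) ^ 2 := by
    rw [sum_comm, ← hone]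
  have hthree : ∑ a ∈ E, ∑ b ∈ E, ∑ c ∈ E, A c a * A c b = ∑ a ∈ E, (∑ b ∈ E, A a b) ^ 2 := by
    rw [← hone]
    calc ∑ a ∈ E, ∑ b ∈ E, ∑ c ∈ E, A c a * A c b
        = ∑ a ∈ E, ∑ c ∈ E, ∑ b ∈ E, A c a * A c b :=
          sum_congr rfl fun a _ => sum_comm
      _ = _ := sum_comm
  have hab : ∑ a ∈ E, ∑ b ∈ E, ∑ c ∈ E, A a b = E.card * ∑ a ∈ E, ∑ b ∈ E, A a b := by
    simp only [sum_const, nsmul_eq_mul, mul_sum]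
  have hac : ∑ a ∈ E, ∑ b ∈ E, ∑ c ∈ E, A a c = E.card * ∑ a ∈ E, ∑ b ∈ E, A a b := by
    simp only [sum_const, nsmul_eq_mul, mul_sum]
  have hbc : ∑ a ∈ E, ∑ b ∈ E, ∑ c ∈ E, A b c = E.card * ∑ a ∈ E, ∑ b ∈ E, A a b := by
    simp only [sum_const, nsmul_eq_mul]
  simp only [hpoint, sum_sub_distrib, sum_add_distrib]
  rw [htwo, hthree, hone A, hone P, hone Q, hone D, hab, hac, hbc]
  have e1 : ∑ a ∈ E, ∑ b ∈ E, A a b = ∑ a ∈ E, (dp a + dq a - 1) := sum_congr rfl hsA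
  have e2 : ∑ a ∈ E, (∑ b ∈ E, A a b) ^ 2 = ∑ a ∈ E, (dp a + dq a - 1) ^ 2 :=
    sum_congr rfl fun a ha => by rw [hsA a ha]
  have e3 : ∑ a ∈ E, (∑ b ∈ E, P a b) ^ 2 = ∑ a ∈ E, dp a ^ 2 :=
    sum_congr rfl fun a ha => by rw [← hdp a ha]
  have e4 : ∑ a ∈ E, (∑ b ∈ E, Q a b) ^ 2 = ∑ a ∈ E, dq a ^ 2 :=
    sum_congr rfl fun a ha => by rw [← hdq a ha]
  have e5 : ∑ a ∈ E, (∑ b ∈ E, D a b) ^ 2 = ∑ a ∈ E, (1 : ℚ) :=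
    sum_congr rfl fun a ha => by rw [hsD a ha, one_pow]
  rw [e1, e2, e3, e4, e5]
  simp only [← mul_sum, sum_sub_distrib, sum_add_distrib, sum_const, nsmul_eq_mul]
  ring

/-- The positions of the downward unit triangles. -/
def downPos (n : ℕ) : Finset (ℕ × ℕ) :=
  (Finset.range n ×ˢ Finset.range n).filter (fun p => p.1 + p.2 + 2 ≤ n)

theorem mem_downPos {n : ℕ} {p : ℕ × ℕ} : p ∈ downPos n ↔ p.1 + p.2 + 2 ≤ n := by
  simp only [downPos, mem_filter, mem_product, mem_range]
  omega

/-- Labels of internal edges: a downward triangle and one of its three sides. -/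
def edgeLabels (n : ℕ) : Finset ((ℕ × ℕ) × Fin 3) := downPos n ×ˢ univ

/-- The side of a downward triangle with a given label. -/
def labelEdge (e : (ℕ × ℕ) × Fin 3) : Sym2 (ℕ × ℕ) :=
  ![s((e.1.1 + 1, e.1.2), (e.1.1, e.1.2 + 1)), s((e.1.1 + 1, e.1.2), (e.1.1 + 1, e.1.2 + 1)),
    s((e.1.1, e.1.2 + 1), (e.1.1 + 1, e.1.2 + 1))] e.2

/-- The position of the upward triangle on the other side of a labelled edge. -/
def upPos (e : (ℕ × ℕ) × Fin 3) : ℕ × ℕ :=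
  ![e.1, (e.1.1 + 1, e.1.2), (e.1.1, e.1.2 + 1)] e.2

theorem labelEdge_mem_downTri {e : (ℕ × ℕ) × Fin 3} {p : ℕ × ℕ} :
    labelEdge e ∈ downTri p ↔ e.1 = p := by
  obtain ⟨⟨i, j⟩, k⟩ := e
  obtain ⟨a, b⟩ := p
  fin_cases k <;> simp [labelEdge, downTri, Prod.ext_iff] <;> omega

theorem labelEdge_mem_upTri {e : (ℕ × ℕ) × Fin 3} {p : ℕ × ℕ} :
    labelEdge e ∈ upTri p ↔ upPos e = p := by
  obtain ⟨⟨i, j⟩, k⟩ := e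
  obtain ⟨a, b⟩ := p
  fin_cases k <;> simp [labelEdge, upTri, upPos, Prod.ext_iff] <;> omega

theorem labelEdge_injective : Function.Injective labelEdge := by
  rintro ⟨⟨i, j⟩, k⟩ ⟨⟨i', j'⟩, k'⟩ h
  fin_cases k <;> fin_cases k' <;> simp [labelEdge, Prod.ext_iff] at h ⊢ <;> omega

theorem upTri_unique {x : Sym2 (ℕ × ℕ)} {p q : ℕ × ℕ} (hp : x ∈ upTri p) (hq : x ∈ upTri q) :
    p = q := by
  obtain ⟨a, b⟩ := p
  obtain ⟨c, d⟩ := q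
  simp only [upTri, mem_insert, mem_singleton] at hp hq
  rcases hp with rfl | rfl | rfl <;> simp [Prod.ext_iff] at hq ⊢ <;> omega

theorem exists_labelEdge_of_mem_downTri {x : Sym2 (ℕ × ℕ)} {p : ℕ × ℕ} (h : x ∈ downTri p) :
    ∃ k, labelEdge (p, k) = x := by
  simp only [downTri, mem_insert, mem_singleton] at h
  rcases h with rfl | rfl | rfl
  · exact ⟨0, rfl⟩
  · exact ⟨1, rfl⟩
  · exact ⟨2, rfl⟩

theorem upTri_ne_downTri (p q : ℕ × ℕ) : upTri p ≠ downTri q := by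
  intro h
  have h0 : labelEdge (q, 0) ∈ upTri p := h ▸ labelEdge_mem_downTri.2 rfl
  have h1 : labelEdge (q, 1) ∈ upTri p := h ▸ labelEdge_mem_downTri.2 rfl
  rw [labelEdge_mem_upTri] at h0 h1
  simpa [upPos, Prod.ext_iff] using h0.trans h1.symm

theorem mem_unitTris {n : ℕ} {t : Finset (Sym2 (ℕ × ℕ))} :
    t ∈ unitTris n ↔ (∃ p : ℕ × ℕ, p.1 + p.2 + 1 ≤ n ∧ upTri p = t) ∨
      ∃ p : ℕ × ℕ, p.1 + p.2 + 2 ≤ n ∧ downTri p = t := by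
  simp only [unitTris, upTris, downTris, mem_union, mem_image, mem_filter, mem_product, mem_range]
  refine or_congr (exists_congr fun p => and_congr_left fun _ => ?_)
    (exists_congr fun p => and_congr_left fun _ => ?_) <;> omega

theorem upPos_le {n : ℕ} {e : (ℕ × ℕ) × Fin 3} (he : e ∈ edgeLabels n) :
    (upPos e).1 + (upPos e).2 + 1 ≤ n := by
  obtain ⟨⟨i, j⟩, k⟩ := e
  simp only [edgeLabels, mem_product, mem_downPos, mem_univ, and_true] at he
  fin_cases k <;> simp [upPos] <;> omega

theorem internalEdges_eq_image (n : ℕ) : internalEdges n = (edgeLabels n).image labelEdge := by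
  ext x
  simp only [internalEdges, mem_filter, mem_image]
  constructor
  · rintro ⟨-, hx⟩
    obtain ⟨s, hs, t, ht, hst⟩ := one_lt_card.1 hx
    simp only [mem_filter, mem_unitTris] at hs ht
    have key : ∀ p : ℕ × ℕ, p.1 + p.2 + 2 ≤ n → x ∈ downTri p →
        ∃ a ∈ edgeLabels n, labelEdge a = x := by
      intro p hp hxp
      obtain ⟨k, hk⟩ := exists_labelEdge_of_mem_downTri hxp
      exact ⟨(p, k), by simpa [edgeLabels, mem_downPos] using hp, hk⟩
    obtain ⟨⟨p, hp, rfl⟩ | ⟨p, hp, rfl⟩, hxs⟩ := hs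
    · obtain ⟨⟨q, hq, rfl⟩ | ⟨q, hq, rfl⟩, hxt⟩ := ht
      · exact absurd (congrArg upTri (upTri_unique hxs hxt)) hst
      · exact key q hq hxt
    · exact key p hp hxs
  · rintro ⟨e, he, rfl⟩
    have hd : downTri e.1 ∈ unitTris n := by
      refine mem_unitTris.2 (Or.inr ⟨e.1, ?_, rfl⟩)
      simpa [edgeLabels, mem_downPos] using he
    have hu : upTri (upPos e) ∈ unitTris n := mem_unitTris.2 (Or.inl ⟨_, upPos_le he, rfl⟩)
    have hed : labelEdge e ∈ downTri e.1 := labelEdge_mem_downTri.2 rfl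
    have heu : labelEdge e ∈ upTri (upPos e) := labelEdge_mem_upTri.2 rfl
    refine ⟨?_, ?_⟩
    · simp only [allEdges, mem_sup, id]
      exact ⟨_, hd, hed⟩
    · exact one_lt_card.2 ⟨_, mem_filter.2 ⟨hu, heu⟩, _, mem_filter.2 ⟨hd, hed⟩,
        upTri_ne_downTri _ _⟩

theorem exists_common_unitTri_iff {n : ℕ} {e f : (ℕ × ℕ) × Fin 3} (he : e ∈ edgeLabels n) :
    (∃ t ∈ unitTris n, labelEdge e ∈ t ∧ labelEdge f ∈ t) ↔ e.1 = f.1 ∨ upPos e = upPos f := by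
  constructor
  · rintro ⟨t, ht, h1, h2⟩
    obtain ⟨p, -, rfl⟩ | ⟨p, -, rfl⟩ := mem_unitTris.1 ht
    · rw [labelEdge_mem_upTri] at h1 h2
      exact Or.inr (h1.trans h2.symm)
    · rw [labelEdge_mem_downTri] at h1 h2
      exact Or.inl (h1.trans h2.symm)
  · rintro (h | h)
    · refine ⟨downTri e.1, mem_unitTris.2 (Or.inr ⟨e.1, ?_, rfl⟩), labelEdge_mem_downTri.2 rfl,
        labelEdge_mem_downTri.2 h.symm⟩
      simpa [edgeLabels, mem_downPos] using he
    · exact ⟨upTri (upPos e), mem_unitTris.2 (Or.inl ⟨_, upPos_le he, rfl⟩),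
        labelEdge_mem_upTri.2 rfl, labelEdge_mem_upTri.2 h.symm⟩

theorem six_mul_L_three (n : ℕ) :
    6 * (L n 3 : ℚ) = ∑ a ∈ edgeLabels n, ∑ b ∈ edgeLabels n, ∑ c ∈ edgeLabels n,
      if ¬ (a.1 = b.1 ∨ upPos a = upPos b) ∧ ¬ (a.1 = c.1 ∨ upPos a = upPos c) ∧
        ¬ (b.1 = c.1 ∨ upPos b = upPos c) then (1 : ℚ) else 0 := by
  let R : Sym2 (ℕ × ℕ) → Sym2 (ℕ × ℕ) → Prop := fun x y => ¬ ∃ t ∈ unitTris n, x ∈ t ∧ y ∈ t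
  have : DecidableRel R := Classical.decRel R
  have hL : L n 3 = (((internalEdges n).powersetCard 3).filter
      (fun S => ∀ a ∈ S, ∀ b ∈ S, a ≠ b → R a b)).card := by
    unfold L
    congr 1
    refine filter_congr fun S _ => ?_
    constructor
    · rintro h a ha b hb hab ⟨t, ht, hat, hbt⟩
      exact hab (card_le_one.1 (h t ht) a (mem_inter.2 ⟨hat, ha⟩) b (mem_inter.2 ⟨hbt, hb⟩))
    · intro h t ht
      refine card_le_one.2 fun a ha b hb => ?_
      rw [mem_inter] at ha hb
      by_contra hab
      exact h a ha.2 b hb.2 hab ⟨t, ht, ha.1, hb.1⟩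
  have hR : ∀ e ∈ edgeLabels n, ∀ f, R (labelEdge e) (labelEdge f) ↔
      ¬ (e.1 = f.1 ∨ upPos e = upPos f) := fun e he f =>
    not_congr (exists_common_unitTri_iff he)
  rw [hL, six_mul_card_powersetCard_three_filter, internalEdges_eq_image]
  · simp only [sum_image labelEdge_injective.injOn]
    refine sum_congr rfl fun a ha => sum_congr rfl fun b hb => sum_congr rfl fun c _ => ?_
    simp only [hR a ha, hR b hb]
  · intro a ha
    rw [internalEdges_eq_image] at ha
    obtain ⟨e, he, rfl⟩ := mem_image.1 ha
    simp [hR e he]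
  · rintro a b h ⟨t, ht, hb, ha⟩
    exact h ⟨t, ht, ha, hb⟩

/-- The number of internal edges of the upward triangle at position `q`. -/
def upDegree (n : ℕ) (q : ℕ × ℕ) : ℕ :=
  (if q.1 + q.2 + 2 ≤ n then 1 else 0) + (if 1 ≤ q.1 then 1 else 0) + if 1 ≤ q.2 then 1 else 0

theorem sum_edgeLabels_fst_eq {n : ℕ} {e : (ℕ × ℕ) × Fin 3} (he : e ∈ edgeLabels n) :
    ∑ f ∈ edgeLabels n, (if e.1 = f.1 then (1 : ℚ) else 0) = 3 := by
  have h : e.1 ∈ downPos n := (mem_product.1 he).1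
  simp only [edgeLabels, sum_product, Fin.sum_univ_three, sum_add_distrib]
  simp [h]
  norm_num

theorem sum_edgeLabels_upPos_eq {n : ℕ} {q : ℕ × ℕ} (hq : q.1 + q.2 + 1 ≤ n) :
    ∑ f ∈ edgeLabels n, (if q = upPos f then (1 : ℚ) else 0) = upDegree n q := by
  obtain ⟨a, b⟩ := q
  simp only at hq
  have h0 : ∑ p ∈ downPos n, (if (a, b) = p then (1 : ℚ) else 0) =
      if a + b + 2 ≤ n then 1 else 0 := by
    simp [mem_downPos]
  have h1 : ∑ p ∈ downPos n, (if (a, b) = (p.1 + 1, p.2) then (1 : ℚ) else 0) =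
      if 1 ≤ a then 1 else 0 := by
    cases a with
    | zero => simp
    | succ a =>
      have : ∀ p : ℕ × ℕ, (a + 1, b) = (p.1 + 1, p.2) ↔ (a, b) = p := by
        simp [Prod.ext_iff]
      simp only [this]
      simp [mem_downPos]
      omega
  have h2 : ∑ p ∈ downPos n, (if (a, b) = (p.1, p.2 + 1) then (1 : ℚ) else 0) =
      if 1 ≤ b then 1 else 0 := by
    cases b with
    | zero => simp
    | succ b =>
      have : ∀ p : ℕ × ℕ, (a, b + 1) = (p.1, p.2 + 1) ↔ (a, b) = p := by
        simp [Prod.ext_iff]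
      simp only [this]
      simp [mem_downPos]
      omega
  simp only [edgeLabels, sum_product, Fin.sum_univ_three, sum_add_distrib, upDegree]
  push_cast
  rw [← h0, ← h1, ← h2]
  rfl

theorem sum_antidiagonal_add_two_of_pos {M : Type*} [AddCommMonoid M] (f : ℕ × ℕ → M) (s : ℕ)
    (c : M) (hc : ∀ i j, i + j = s → f (i + 1, j + 1) = c) :
    ∑ p ∈ antidiagonal (s + 2), f p = f (0, s + 2) + (s + 1) • c + f (s + 2, 0) := by
  have h : ∑ p ∈ antidiagonal s, f (p.1 + 1, p.2 + 1) = (s + 1) • c := by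
    rw [← Nat.card_antidiagonal s, ← sum_const]
    exact sum_congr rfl fun p hp => hc _ _ (HasAntidiagonal.mem_antidiagonal.1 hp)
  rw [Nat.sum_antidiagonal_succ, Nat.sum_antidiagonal_succ', h, ← add_assoc, add_right_comm]

theorem sum_downPos_succ {M : Type*} [AddCommMonoid M] (f : ℕ × ℕ → M) (m : ℕ) :
    ∑ p ∈ downPos (m + 2), f p = ∑ p ∈ downPos (m + 1), f p + ∑ p ∈ antidiagonal m, f p := by
  rw [← sum_union]
  · refine sum_congr ?_ fun _ _ => rfl
    ext p
    simp only [mem_union, mem_downPos, HasAntidiagonal.mem_antidiagonal]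
    omega
  · rw [disjoint_left]
    intro p
    simp only [mem_downPos, HasAntidiagonal.mem_antidiagonal]
    omega

theorem sum_downPos_interior (F : ℕ → ℚ) (m : ℕ) :
    ∑ p ∈ downPos (m + 2), (F (1 + (if 1 ≤ p.1 then 1 else 0) + (if 1 ≤ p.2 then 1 else 0)) +
      F (2 + (if 1 ≤ p.2 then 1 else 0)) + F (2 + (if 1 ≤ p.1 then 1 else 0))) =
      F 1 + (2 + 4 * m) * F 2 + (2 * m + 3 * (m * (m - 1) / 2)) * F 3 := by
  induction m with
  | zero =>
    have : downPos (0 + 2) = {(0, 0)} := by decide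
    rw [this]
    simp
    ring
  | succ m ih =>
    rw [sum_downPos_succ, ih]
    cases m with
    | zero =>
      rw [Nat.sum_antidiagonal_succ]
      simp
      ring
    | succ m =>
      rw [sum_antidiagonal_add_two_of_pos _ m (3 * F 3)]
      · simp
        ring
      · intro i j _
        simp
        ring

theorem sum_edgeLabels_upDegree (F : ℕ → ℚ) (m : ℕ) :
    ∑ e ∈ edgeLabels (m + 2), F (upDegree (m + 2) (upPos e)) =
      3 * F 1 + 6 * m * F 2 + 3 * (m * (m - 1) / 2) * F 3 := by
  simp only [edgeLabels, sum_product, Fin.sum_univ_three]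
  cases m with
  | zero =>
    have : downPos (0 + 2) = {(0, 0)} := by decide
    rw [this]
    simp [upDegree, upPos]
    ring
  | succ m =>
    rw [sum_downPos_succ]
    have hin : ∀ p ∈ downPos (m + 2),
        F (upDegree (m + 1 + 2) (upPos (p, 0))) + F (upDegree (m + 1 + 2) (upPos (p, 1))) +
          F (upDegree (m + 1 + 2) (upPos (p, 2))) =
        F (1 + (if 1 ≤ p.1 then 1 else 0) + (if 1 ≤ p.2 then 1 else 0)) +
          F (2 + (if 1 ≤ p.2 then 1 else 0)) + F (2 + (if 1 ≤ p.1 then 1 else 0)) := by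
      rintro ⟨i, j⟩ hp
      rw [mem_downPos] at hp
      simp only at hp
      have h1 : i + j + 2 ≤ m + 1 + 2 := by omega
      have h2 : i + 1 + j + 2 ≤ m + 1 + 2 := by omega
      have h3 : i + (j + 1) + 2 ≤ m + 1 + 2 := by omega
      have h4 : ∀ x, 1 + x + 1 = 2 + x := by omega
      simp [upDegree, upPos, h1, h2, h3, h4]
      rfl
    rw [sum_congr rfl hin, sum_downPos_interior]
    cases m with
    | zero =>
      rw [Nat.sum_antidiagonal_succ]
      simp [upDegree, upPos]
      ring
    | succ m =>
      rw [sum_antidiagonal_add_two_of_pos _ m (F 3 + 2 * F 2)]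
      · simp [upDegree, upPos]
        ring
      · intro i j h
        have h1 : i + 1 + (j + 1) + 2 ≤ m + 1 + 1 + 2 := by omega
        have h2 : ¬ i + 1 + 1 + (j + 1) + 2 ≤ m + 1 + 1 + 2 := by omega
        have h3 : ¬ i + 1 + (j + 1 + 1) + 2 ≤ m + 1 + 1 + 2 := by omega
        simp [upDegree, upPos, h1, h2, h3]
        ring

/-- Closed form for `L_{n,3}` for `n ≥ 2`. -/
theorem L_three (n : ℕ) (hn : 2 ≤ n) :
    (L n 3 : ℚ) = 1 / 16 * ((n : ℚ) - 2) *
      (9 * (n : ℚ) ^ 5 - 9 * (n : ℚ) ^ 4 - 81 * (n : ℚ) ^ 3 + 81 * (n : ℚ) ^ 2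
        + 160 * (n : ℚ) - 192) := by
  obtain ⟨m, rfl⟩ := Nat.exists_eq_add_of_le' hn
  have h6 := six_mul_L_three (m + 2)
  have hinj : ∀ a b : (ℕ × ℕ) × Fin 3, a.1 = b.1 → upPos a = upPos b → a = b := by
    rintro ⟨p, k⟩ ⟨q, l⟩ h h'
    dsimp only at h
    subst h
    fin_cases k <;> fin_cases l <;> simp [upPos, Prod.ext_iff] at h' ⊢
  rw [sum_matching_triples (edgeLabels (m + 2)) Prod.fst upPos hinj (fun _ => 3)
    (fun e => upDegree (m + 2) (upPos e)) (fun e he => sum_edgeLabels_fst_eq he)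
    (fun e he => sum_edgeLabels_upPos_eq (upPos_le he))] at h6
  have hcard : ((edgeLabels (m + 2)).card : ℚ) = 3 * ((m + 1) * (m + 2) / 2) := by
    have h := sum_edgeLabels_upDegree (fun _ => 1) m
    simp only [sum_const, nsmul_eq_mul, mul_one] at h
    rw [h]
    ring
  rw [hcard] at h6
  have h := sum_edgeLabels_upDegree (fun d => (3 * (((m : ℚ) + 1) * (m + 2) / 2)) ^ 2 -
    3 * (3 * (((m : ℚ) + 1) * (m + 2) / 2)) * (3 + (d : ℚ) - 1) + 3 * (3 + (d : ℚ) - 1) ^ 2 -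
    3 ^ 2 - (d : ℚ) ^ 2 + 1) m
  rw [h] at h6
  push_cast at h6 ⊢
  linear_combination h6 / 6
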